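/- Let n ≥ 1 and N ≥ n be integers, m₁ ≥ 0 and m₂ ≥ −3 integers, and for each ℓ = 1, …, N let P_ℓ : ℝ² → ℝ be a homogeneous polynomial function of degree 3ℓ + m₂. Suppose there exists ε > 0 such that P₁(z) > 0 for all z with 0 < ‖z‖₂ ≤ ε. For j ∈ {n, N} define K_j(z) := ∑_{ℓ=1}^{j} R(z)^{−2(ℓ+m₁)+1} P_ℓ(z) for z ≠ (0,0). Then there exists ε' > 0 such that K_n(z) > 0 for all 0 < ‖z‖₂ ≤ ε', and the function ρ defined by ρ(z) = K_N(z)/K_n(z) for 0 < ‖z‖₂ ≤ ε' and ρ(0,0) = 1 is (n−1) times continuously differentiable at the origin, with every partial derivative of ρ of order between 1 and n−1 equal to 0 at the origin. -/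

import Mathlib

open Filter Topology Set
open scoped ContDiff

lemma iter_comp_affine {E F : Type*} [NormedAddCommGroup E] [NormedSpace ℝ E]
    [NormedAddCommGroup F] [NormedSpace ℝ F] (k : ℕ) (G : F → ℝ) (L : E →L[ℝ] F) (v : F) (x : E)
    (h : ContDiffAt ℝ k G (v + L x)) :
    iteratedFDeriv ℝ k (fun y => G (v + L y)) x =
      (iteratedFDeriv ℝ k G (v + L x)).compContinuousLinearMap fun _ => L := by
  have h1 : ContDiffAt ℝ k (fun y => G (v + y)) (L x) := by
    apply ContDiffAt.comp (L x) (g := G) (f := fun y => v + y) h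
    fun_prop
  obtain ⟨u, hu, hcu⟩ := h1.contDiffOn (m := k) le_rfl (by simp)
  obtain ⟨o, hou, ho, hxo⟩ := mem_nhds_iff.1 hu
  have h2 := L.iteratedFDerivWithin_comp_right (hcu.mono hou) ho.uniqueDiffOn
    (ho.preimage L.continuous).uniqueDiffOn hxo (i := k) le_rfl
  rw [iteratedFDerivWithin_of_isOpen k ho hxo,
    iteratedFDerivWithin_of_isOpen k (ho.preimage L.continuous) hxo,
    iteratedFDeriv_comp_add_left] at h2
  exact h2

lemma core_bound1 {E : Type*} [NormedAddCommGroup E] [NormedSpace ℝ E] [ProperSpace E]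
    (G : ℝ × E → ℝ) (hG : ∀ w : E, ‖w‖ = 1 → ContDiffAt ℝ ∞ G (0, w)) (k : ℕ) :
    ∃ C : ℝ, ∀ᶠ t in 𝓝 (0 : ℝ), ∀ w ∈ Metric.sphere (0 : E) 1,
      ContDiffAt ℝ k G (t, w) ∧ ‖iteratedFDeriv ℝ k G (t, w)‖ ≤ C := by
  have hGk : ∀ w ∈ Metric.sphere (0 : E) 1, ContDiffAt ℝ k G (0, w) := fun w hw =>
    (hG w (by simpa using hw)).of_le (mod_cast le_top)
  have hc : ∀ w ∈ Metric.sphere (0 : E) 1, ContinuousAt (iteratedFDeriv ℝ k G) (0, w) :=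
    fun w hw => (hGk w hw).continuousAt_iteratedFDeriv le_rfl
  obtain ⟨C, hC⟩ := (isCompact_sphere (0 : E) 1).exists_bound_of_continuousOn
    (f := fun w => iteratedFDeriv ℝ k G (0, w)) (fun w hw => by
      apply ContinuousAt.continuousWithinAt
      exact ContinuousAt.comp (g := iteratedFDeriv ℝ k G) (f := fun w => ((0 : ℝ), w)) (hc w hw)
        (by fun_prop))
  refine ⟨C + 1, (isCompact_sphere (0 : E) 1).eventually_forall_of_forall_eventually ?_⟩
  intro w hw
  have h1 := (hGk w hw).eventually (by simp)
  have h2 : ∀ᶠ z in 𝓝 ((0 : ℝ), w), ‖iteratedFDeriv ℝ k G z‖ < C + 1 :=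
    (hc w hw).norm.eventually_lt continuousAt_const (by have := hC w hw; linarith)
  filter_upwards [h1, h2] with z hz1 hz2
  exact ⟨hz1, hz2.le⟩

lemma core_bound2 {E : Type*} [NormedAddCommGroup E] [NormedSpace ℝ E] [ProperSpace E]
    (n : ℕ) (f : E → ℝ)
    (G : ℝ × E → ℝ) (hG : ∀ w : E, ‖w‖ = 1 → ContDiffAt ℝ ∞ G (0, w))
    (hfG : ∀ t : ℝ, 0 < t → ∀ w : E, w ≠ 0 → f (t • w) = t ^ n * G (t, w)) (k : ℕ) :
    ∃ C : ℝ, ∀ᶠ z in 𝓝 (0 : E), z ≠ 0 →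
      ContDiffAt ℝ k f z ∧ ‖iteratedFDeriv ℝ k f z‖ * ‖z‖ ^ k ≤ C * ‖z‖ ^ n := by
  obtain ⟨C, hC⟩ := core_bound1 G hG k
  refine ⟨C, ?_⟩
  have hn : Tendsto (fun z : E => ‖z‖) (𝓝 0) (𝓝 0) := by
    simpa using (continuous_norm (E := E)).tendsto 0
  filter_upwards [hn.eventually hC] with z hz hz0
  set t := ‖z‖ with ht
  have htp : 0 < t := norm_pos_iff.2 hz0
  obtain ⟨h1, h2⟩ := hz (t⁻¹ • z) (by simp [norm_smul, ← ht, htp.ne', abs_of_pos htp])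
  let L : E →L[ℝ] ℝ × E := t⁻¹ • ContinuousLinearMap.inr ℝ ℝ E
  let v : ℝ × E := (t, 0)
  have hL : ∀ y, v + L y = (t, t⁻¹ • y) := by intro y; simp [L, v]
  have hLn : ‖L‖ ≤ t⁻¹ := by
    refine ContinuousLinearMap.opNorm_le_bound _ (by positivity) fun y => ?_
    simp [L, norm_smul, abs_of_pos htp]
    positivity
  have hev : f =ᶠ[𝓝 z] fun y => t ^ n • G (v + L y) := by
    filter_upwards [isOpen_ne.mem_nhds hz0] with y hy
    rw [hL, smul_eq_mul, ← hfG t htp _ (smul_ne_zero (inv_ne_zero htp.ne') hy), smul_smul,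
      mul_inv_cancel₀ htp.ne', one_smul]
  rw [← hL] at h1 h2
  have h3 : ContDiffAt ℝ k (fun y => G (v + L y)) z :=
    ContDiffAt.comp z (g := G) (f := fun y => v + L y) h1 (by fun_prop)
  refine ⟨(h3.const_smul (t ^ n)).congr_of_eventuallyEq hev, ?_⟩
  have h4 : iteratedFDeriv ℝ k f z = t ^ n • iteratedFDeriv ℝ k (fun y => G (v + L y)) z := by
    rw [(Filter.EventuallyEq.iteratedFDeriv ℝ hev k).self_of_nhds]
    exact iteratedFDeriv_const_smul_apply (a := t ^ n) (f := fun y => G (v + L y)) h3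
  rw [h4, iter_comp_affine k G L v z h1, norm_smul, Real.norm_of_nonneg (by positivity)]
  have h5 := (iteratedFDeriv ℝ k G (v + L z)).norm_compContinuousLinearMap_le (fun _ => L)
  have h6 : ‖iteratedFDeriv ℝ k G (v + L z)‖ * ∏ _i : Fin k, ‖L‖ ≤ C * t⁻¹ ^ k := by
    rw [Finset.prod_const, Finset.card_univ, Fintype.card_fin]
    have : 0 ≤ C := (norm_nonneg _).trans h2
    gcongr
  calc _ ≤ t ^ n * (C * t⁻¹ ^ k) * t ^ k := by gcongr; exact h5.trans h6
    _ = C * t ^ n * (t⁻¹ * t) ^ k := by rw [mul_pow]; ring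
    _ = _ := by rw [inv_mul_cancel₀ htp.ne']; simp

open Classical in
lemma core {E : Type*} [NormedAddCommGroup E] [NormedSpace ℝ E] [ProperSpace E]
    (n : ℕ) (f : E → ℝ) (hf0 : f 0 = 0)
    (G : ℝ × E → ℝ) (hG : ∀ w : E, ‖w‖ = 1 → ContDiffAt ℝ ∞ G (0, w))
    (hfG : ∀ t : ℝ, 0 < t → ∀ w : E, w ≠ 0 → f (t • w) = t ^ (n + 1) * G (t, w)) :
    ContDiffAt ℝ n f 0 ∧ ∀ k ≤ n, iteratedFDeriv ℝ k f 0 = 0 := by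
  choose C hC using core_bound2 (n + 1) f G hG hfG
  have hall : ∀ᶠ z in 𝓝 (0 : E), ∀ k ∈ Finset.range (n + 2), z ≠ 0 →
      ContDiffAt ℝ k f z ∧ ‖iteratedFDeriv ℝ k f z‖ * ‖z‖ ^ k ≤ C k * ‖z‖ ^ (n + 1) :=
    (Finset.eventually_all _).2 fun k _ => hC k
  obtain ⟨r, hr, hball⟩ := Metric.eventually_nhds_iff_ball.1 hall
  let p : E → FormalMultilinearSeries ℝ E ℝ := fun z k =>
    if z = 0 then 0 else iteratedFDeriv ℝ k f z
  have hp0 : ∀ k, p 0 k = 0 := fun k => by simp [p]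
  have hpne : ∀ z, z ≠ 0 → ∀ k, (p · k) =ᶠ[𝓝 z] iteratedFDeriv ℝ k f := fun z hz k => by
    filter_upwards [isOpen_ne.mem_nhds hz] with y hy
    exact if_neg hy
  have hbd : ∀ z ∈ Metric.ball (0 : E) r, ∀ k ≤ n, ‖p z k‖ ≤ C k * ‖z‖ ^ (n + 1 - k) := by
    intro z hz k hk
    by_cases h0 : z = 0
    · subst h0; rw [hp0, norm_zero, norm_zero, zero_pow (by omega), mul_zero]
    · have h1 := (hball z hz k (by simp; omega) h0).2
      have hz' : 0 < ‖z‖ := norm_pos_iff.2 h0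
      have h2 : p z k = iteratedFDeriv ℝ k f z := if_neg h0
      rw [h2]
      have h3 : ‖z‖ ^ (n + 1) = ‖z‖ ^ (n + 1 - k) * ‖z‖ ^ k := by
        rw [← pow_add]; congr 1; omega
      rw [h3, ← mul_assoc] at h1
      exact le_of_mul_le_mul_right h1 (by positivity)
  have hO : ∀ k ≤ n, (fun z => p z k) =O[𝓝 0] fun z => ‖z‖ ^ (n + 1 - k) := by
    intro k hk
    apply Asymptotics.IsBigO.of_bound (C k)
    filter_upwards [Metric.ball_mem_nhds 0 hr] with z hz
    simpa using hbd z hz k hk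
  have hT : HasFTaylorSeriesUpToOn n f p (Metric.ball 0 r) := by
    refine ⟨?_, ?_, ?_⟩
    · intro z hz
      by_cases h0 : z = 0
      · subst h0; rw [hp0, hf0]; rfl
      · have h2 : p z 0 = iteratedFDeriv ℝ 0 f z := if_neg h0
        rw [h2]; simp [ContinuousMultilinearMap.curry0]
    · intro m hm z hz
      have hm' : m < n := by exact_mod_cast hm
      apply HasFDerivAt.hasFDerivWithinAt
      by_cases h0 : z = 0
      · subst h0
        rw [hp0]
        have : (0 : ContinuousMultilinearMap ℝ (fun _ : Fin (m + 1) => E) ℝ).curryLeft = 0 := by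
          ext; simp
        rw [this]
        rw [hasFDerivAt_iff_isLittleO_nhds_zero]
        have h1 : (fun z : E => ‖z‖ ^ (n + 1 - m)) =o[𝓝 0] fun z => z := by
          have := (Asymptotics.isLittleO_norm_pow_id (E' := E) (n := n + 1 - m) (by omega))
          simpa using this
        simpa [hp0] using (hO m hm'.le).trans_isLittleO h1
      · have hcd := (hball z hz (m + 1) (by simp; omega) h0).1
        have hd := hcd.differentiableAt_iteratedFDeriv (m := m) (by exact_mod_cast m.lt_succ_self)
        have h2 : p z m.succ = iteratedFDeriv ℝ (m + 1) f z := if_neg h0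
        rw [h2]
        have h3 := hd.hasFDerivAt.congr_of_eventuallyEq (hpne z h0 m)
        convert h3 using 1
        ext u v
        rw [ContinuousMultilinearMap.curryLeft_apply, iteratedFDeriv_succ_apply_left]
        simp
    · intro m hm z hz
      have hm' : m ≤ n := by exact_mod_cast hm
      apply ContinuousAt.continuousWithinAt
      by_cases h0 : z = 0
      · subst h0
        have h1 : Tendsto (fun z : E => ‖z‖ ^ (n + 1 - m)) (𝓝 0) (𝓝 0) := by
          have : Continuous (fun z : E => ‖z‖ ^ (n + 1 - m)) := by fun_prop
          have h := this.tendsto 0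
          rwa [norm_zero, zero_pow (by omega)] at h
        have := (hO m hm').trans_tendsto h1
        show Tendsto _ _ (𝓝 (p 0 m))
        rw [hp0]; exact this
      · have hcd := (hball z hz m (by simp; omega) h0).1
        exact (hcd.continuousAt_iteratedFDeriv le_rfl).congr (hpne z h0 m).symm
  refine ⟨?_, ?_⟩
  · rw [← contDiffWithinAt_univ, contDiffWithinAt_nat]
    exact ⟨_, by simpa using Metric.ball_mem_nhds 0 hr, p, hT⟩
  · intro k hk
    have := hT.eq_iteratedFDerivWithin_of_uniqueDiffOn (m := k) (by exact_mod_cast hk)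
      Metric.isOpen_ball.uniqueDiffOn (Metric.mem_ball_self hr)
    rw [iteratedFDerivWithin_of_isOpen k Metric.isOpen_ball (Metric.mem_ball_self hr), hp0] at this
    exact this.symm

lemma quad_pos (a b c : ℝ) (ha : 0 < a) (hd : 0 < 4 * a * c - b ^ 2) (z : ℝ × ℝ) (hz : z ≠ 0) :
    0 < a * z.1 ^ 2 + b * z.1 * z.2 + c * z.2 ^ 2 := by
  obtain ⟨x, y⟩ := z
  have h : 0 < 4 * a * (a * x ^ 2 + b * x * y + c * y ^ 2) := by
    have e : 4 * a * (a * x ^ 2 + b * x * y + c * y ^ 2) =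
      (2 * a * x + b * y) ^ 2 + (4 * a * c - b ^ 2) * y ^ 2 := by ring
    rw [e]
    by_cases hy : y = 0
    · subst hy
      have hx : x ≠ 0 := by rintro rfl; exact hz rfl
      have : 0 < (2 * a * x + b * 0) ^ 2 := by
        rw [mul_zero, add_zero]; positivity
      simpa using this
    · have : 0 < y ^ 2 := by positivity
      nlinarith [sq_nonneg (2 * a * x + b * y), mul_pos hd this]
  exact pos_of_mul_pos_right h (by positivity)

lemma rpow_scale (t q s : ℝ) (ht : 0 < t) (hq : 0 < q) (ℓ m₁ d : ℕ) (m₂ : ℤ) (hℓ : 1 ≤ ℓ)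
    (hd : (d : ℤ) = 3 * ℓ + m₂) :
    (t ^ 2 * q) ^ ((-2 * ((ℓ : ℝ) + (m₁ : ℝ)) + 1) / 2) * (t ^ d * s) =
      t ^ ((2 : ℝ) - 2 * m₁ + m₂) *
        (t ^ (ℓ - 1) * (q ^ ((-2 * ((ℓ : ℝ) + (m₁ : ℝ)) + 1) / 2) * s)) := by
  rw [Real.mul_rpow (by positivity) hq.le]
  have hd' : (d : ℝ) = 3 * ℓ + m₂ := by exact_mod_cast hd
  have h1 : (t ^ 2) ^ ((-2 * ((ℓ : ℝ) + (m₁ : ℝ)) + 1) / 2) * t ^ d =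
      t ^ ((2 : ℝ) - 2 * m₁ + m₂) * t ^ (ℓ - 1) := by
    rw [← Real.rpow_natCast t 2, ← Real.rpow_mul ht.le, ← Real.rpow_natCast t d,
      ← Real.rpow_natCast t (ℓ - 1), ← Real.rpow_add ht, ← Real.rpow_add ht, hd',
      Nat.cast_sub hℓ]
    congr 1
    push_cast
    ring
  calc _ = ((t ^ 2) ^ ((-2 * ((ℓ : ℝ) + (m₁ : ℝ)) + 1) / 2) * t ^ d) *
        (q ^ ((-2 * ((ℓ : ℝ) + (m₁ : ℝ)) + 1) / 2) * s) := by ring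
    _ = _ := by rw [h1]; ring


/-- singularity division regularity: with `K_j(z) = ∑_{ℓ=1}^{j}
R(z)^(−2(ℓ+m₁)+1) P_ℓ(z)` and `P₁ > 0` on a punctured disk, there is `ε' > 0`
such that `K_n > 0` on the punctured `ε'`-disk, and any function `ρ` with
`ρ(0) = 1` and `ρ(z) = K_N(z)/K_n(z)` for `0 < ‖z‖₂ ≤ ε'` is `C^(n−1)` at the
origin with all derivatives of order `1 ≤ k ≤ n−1` vanishing there. -/
theorem stmt_9 (a b c : ℝ) (ha : 0 < a) (hc : 0 < c) (hd : 0 < 4 * a * c - b ^ 2)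
    (n N : ℕ) (hn : 1 ≤ n) (hnN : n ≤ N)
    (m₁ : ℕ) (m₂ : ℤ) (hm₂ : -3 ≤ m₂)
    (P : ℕ → ℝ × ℝ → ℝ)
    (hhom : ∀ ℓ ∈ Finset.Icc 1 N, ∃ cα : ℕ → ℝ, ∀ z : ℝ × ℝ,
      P ℓ z = ∑ j ∈ Finset.range ((3 * (ℓ : ℤ) + m₂).toNat + 1),
        cα j * z.1 ^ j * z.2 ^ ((3 * (ℓ : ℤ) + m₂).toNat - j))
    (ε : ℝ) (hε : 0 < ε)
    (hP1 : ∀ z : ℝ × ℝ, z ≠ 0 → Real.sqrt (z.1 ^ 2 + z.2 ^ 2) ≤ ε → 0 < P 1 z)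
    (K : ℕ → ℝ × ℝ → ℝ)
    (hK : ∀ j : ℕ, ∀ z : ℝ × ℝ, z ≠ 0 →
      K j z = ∑ ℓ ∈ Finset.Icc 1 j,
        (a * z.1 ^ 2 + b * z.1 * z.2 + c * z.2 ^ 2)
            ^ ((-2 * ((ℓ : ℝ) + (m₁ : ℝ)) + 1) / 2) * P ℓ z) :
    ∃ ε' > (0 : ℝ),
      (∀ z : ℝ × ℝ, z ≠ 0 → Real.sqrt (z.1 ^ 2 + z.2 ^ 2) ≤ ε' → 0 < K n z) ∧
      ∀ ρ : ℝ × ℝ → ℝ, ρ 0 = 1 →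
        (∀ z : ℝ × ℝ, z ≠ 0 → Real.sqrt (z.1 ^ 2 + z.2 ^ 2) ≤ ε' →
          ρ z = K N z / K n z) →
        ContDiffAt ℝ (n - 1) ρ 0 ∧
          ∀ k : ℕ, 1 ≤ k → k ≤ n - 1 → iteratedFDeriv ℝ k ρ 0 = 0 := by
  classical
  set Q : ℝ × ℝ → ℝ := fun z => a * z.1 ^ 2 + b * z.1 * z.2 + c * z.2 ^ 2 with hQ
  have hQpos : ∀ z, z ≠ 0 → 0 < Q z := quad_pos a b c ha hd
  set h : ℕ → ℝ × ℝ → ℝ := fun ℓ z => Q z ^ ((-2 * ((ℓ : ℝ) + (m₁ : ℝ)) + 1) / 2) * P ℓ z with hh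
  have hK' : ∀ j z, z ≠ 0 → K j z = ∑ ℓ ∈ Finset.Icc 1 j, h ℓ z := hK
  set σ : ℝ := (2 : ℝ) - 2 * m₁ + m₂ with hσ
  -- homogeneity
  have hPhom : ∀ ℓ ∈ Finset.Icc 1 N, ∀ (t : ℝ) (w : ℝ × ℝ),
      P ℓ (t • w) = t ^ (3 * (ℓ : ℤ) + m₂).toNat * P ℓ w := by
    intro ℓ hℓ t w
    obtain ⟨cα, hcα⟩ := hhom ℓ hℓ
    rw [hcα, hcα, Finset.mul_sum]
    refine Finset.sum_congr rfl fun j hj => ?_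
    have hj' : j ≤ (3 * (ℓ : ℤ) + m₂).toNat := by
      rw [Finset.mem_range] at hj; omega
    rw [← pow_mul_pow_sub t hj']
    simp only [Prod.smul_fst, Prod.smul_snd, smul_eq_mul, mul_pow]
    ring
  have hhhom : ∀ ℓ ∈ Finset.Icc 1 N, ∀ t : ℝ, 0 < t → ∀ w : ℝ × ℝ, w ≠ 0 →
      h ℓ (t • w) = t ^ σ * (t ^ (ℓ - 1) * h ℓ w) := by
    intro ℓ hℓ t ht w hw
    have h1 : 1 ≤ ℓ := (Finset.mem_Icc.1 hℓ).1
    have hq : Q (t • w) = t ^ 2 * Q w := by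
      simp only [hQ, Prod.smul_fst, Prod.smul_snd, smul_eq_mul]; ring
    simp only [hh]
    rw [hq, hPhom ℓ hℓ]
    exact rpow_scale t (Q w) (P ℓ w) ht (hQpos w hw) ℓ m₁ _ m₂ h1
      (Int.toNat_of_nonneg (by omega))
  -- smoothness
  have hhs : ∀ ℓ ∈ Finset.Icc 1 N, ∀ w : ℝ × ℝ, w ≠ 0 → ContDiffAt ℝ ∞ (h ℓ) w := by
    intro ℓ hℓ w hw
    obtain ⟨cα, hcα⟩ := hhom ℓ hℓ
    have hP : ContDiff ℝ ∞ (P ℓ) := by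
      rw [show P ℓ = _ from funext hcα]
      fun_prop
    have hQs : ContDiff ℝ ∞ Q := by simp only [hQ]; fun_prop
    exact (hQs.contDiffAt.rpow_const_of_ne (hQpos w hw).ne').mul hP.contDiffAt
  -- positivity of the leading term
  have hh1 : ∀ w : ℝ × ℝ, w ≠ 0 → 0 < h 1 w := by
    intro w hw
    have h1N : 1 ∈ Finset.Icc 1 N := Finset.mem_Icc.2 ⟨le_rfl, hn.trans hnN⟩
    refine mul_pos (Real.rpow_pos_of_pos (hQpos w hw) _) ?_
    set r := Real.sqrt (w.1 ^ 2 + w.2 ^ 2)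
    have hr : 0 ≤ r := Real.sqrt_nonneg _
    have ht : 0 < ε / (r + 1) := by positivity
    have := hP1 ((ε / (r + 1)) • w) (smul_ne_zero ht.ne' hw) (by
      have e : ((ε / (r + 1)) • w).1 ^ 2 + ((ε / (r + 1)) • w).2 ^ 2 =
          (ε / (r + 1)) ^ 2 * (w.1 ^ 2 + w.2 ^ 2) := by
        simp only [Prod.smul_fst, Prod.smul_snd, smul_eq_mul]; ring
      rw [e, Real.sqrt_mul (by positivity), Real.sqrt_sq ht.le]
      change ε / (r + 1) * r ≤ ε
      rw [div_mul_eq_mul_div, div_le_iff₀ (by positivity)]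
      nlinarith)
    rw [hPhom 1 h1N] at this
    exact pos_of_mul_pos_right this (by positivity)
  set D : ℝ × (ℝ × ℝ) → ℝ := fun x => ∑ ℓ ∈ Finset.Icc 1 n, x.1 ^ (ℓ - 1) * h ℓ x.2 with hD
  set M : ℝ × (ℝ × ℝ) → ℝ :=
    fun x => ∑ ℓ ∈ Finset.Icc (n + 1) N, x.1 ^ (ℓ - (n + 1)) * h ℓ x.2 with hM
  have hD0 : ∀ w : ℝ × ℝ, w ≠ 0 → 0 < D (0, w) := by
    intro w hw
    have : D (0, w) = h 1 w := by
      simp only [hD]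
      rw [Finset.sum_eq_single_of_mem 1 (Finset.mem_Icc.2 ⟨le_rfl, hn⟩)]
      · simp
      · intro ℓ hℓ hne
        have := (Finset.mem_Icc.1 hℓ).1
        rw [zero_pow (by omega), zero_mul]
    rw [this]; exact hh1 w hw
  have hterm : ∀ ℓ ∈ Finset.Icc 1 N, ∀ (i : ℕ) (t : ℝ) (w : ℝ × ℝ), w ≠ 0 →
      ContDiffAt ℝ ∞ (fun x : ℝ × (ℝ × ℝ) => x.1 ^ i * h ℓ x.2) (t, w) := by
    intro ℓ hℓ i t w hw
    have h1 : ContDiffAt ℝ ∞ (fun x : ℝ × (ℝ × ℝ) => h ℓ x.2) (t, w) :=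
      ContDiffAt.comp (t, w) (g := h ℓ) (f := fun x : ℝ × (ℝ × ℝ) => x.2) (hhs ℓ hℓ w hw)
        (by fun_prop)
    exact ContDiffAt.mul (by fun_prop) h1
  have hDs : ∀ (t : ℝ) (w : ℝ × ℝ), w ≠ 0 → ContDiffAt ℝ ∞ D (t, w) := by
    intro t w hw
    refine ContDiffAt.sum fun ℓ hℓ => hterm ℓ ?_ _ t w hw
    rw [Finset.mem_Icc] at hℓ ⊢; omega
  have hMs : ∀ (t : ℝ) (w : ℝ × ℝ), w ≠ 0 → ContDiffAt ℝ ∞ M (t, w) := by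
    intro t w hw
    refine ContDiffAt.sum fun ℓ hℓ => hterm ℓ ?_ _ t w hw
    rw [Finset.mem_Icc] at hℓ ⊢; omega
  have hKn : ∀ t : ℝ, 0 < t → ∀ w : ℝ × ℝ, w ≠ 0 → K n (t • w) = t ^ σ * D (t, w) := by
    intro t ht w hw
    rw [hK' n _ (smul_ne_zero ht.ne' hw)]
    simp only [hD]
    rw [Finset.mul_sum]
    refine Finset.sum_congr rfl fun ℓ hℓ => hhhom ℓ ?_ t ht w hw
    rw [Finset.mem_Icc] at hℓ ⊢; omega
  have hKN : ∀ t : ℝ, 0 < t → ∀ w : ℝ × ℝ, w ≠ 0 →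
      K N (t • w) - K n (t • w) = t ^ σ * (t ^ n * M (t, w)) := by
    intro t ht w hw
    have h0 := smul_ne_zero ht.ne' hw
    have hsplit : K N (t • w) = K n (t • w) + ∑ ℓ ∈ Finset.Icc (n + 1) N, h ℓ (t • w) := by
      rw [hK' N _ h0, hK' n _ h0, ← Finset.sum_union]
      · congr 1
        ext ℓ; simp only [Finset.mem_union, Finset.mem_Icc]; omega
      · rw [Finset.disjoint_left]
        intro ℓ; simp only [Finset.mem_Icc]; omega
    rw [hsplit, add_sub_cancel_left]
    simp only [hM]
    rw [Finset.mul_sum, Finset.mul_sum]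
    refine Finset.sum_congr rfl fun ℓ hℓ => ?_
    rw [Finset.mem_Icc] at hℓ
    rw [hhhom ℓ (by rw [Finset.mem_Icc]; omega) t ht w hw, ← mul_assoc (t ^ n), ← pow_add]
    congr 4
    omega
  -- uniform positivity of the denominator
  have hne1 : ∀ w ∈ Metric.sphere (0 : ℝ × ℝ) 1, w ≠ 0 := by
    rintro w hw rfl; simp at hw
  have hDev : ∀ᶠ t in 𝓝 (0 : ℝ), ∀ w ∈ Metric.sphere (0 : ℝ × ℝ) 1, 0 < D (t, w) := by
    refine (isCompact_sphere (0 : ℝ × ℝ) 1).eventually_forall_of_forall_eventually ?_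
    intro w hw
    exact continuousAt_const.eventually_lt (hDs 0 w (hne1 w hw)).continuousAt (hD0 w (hne1 w hw))
  obtain ⟨δ, hδ, hδD⟩ := Metric.eventually_nhds_iff_ball.1 hDev
  have hKpos : ∀ z : ℝ × ℝ, z ≠ 0 → ‖z‖ ≤ δ / 2 → 0 < K n z := by
    intro z hz hzδ
    have ht : 0 < ‖z‖ := norm_pos_iff.2 hz
    have e : z = ‖z‖ • (‖z‖⁻¹ • z) := by rw [smul_smul, mul_inv_cancel₀ ht.ne', one_smul]
    rw [e, hKn _ ht _ (smul_ne_zero (inv_ne_zero ht.ne') hz)]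
    refine mul_pos (Real.rpow_pos_of_pos ht _) (hδD _ ?_ _ ?_)
    · rw [mem_ball_zero_iff, norm_norm]; linarith
    · simp [norm_smul, ht.ne']
  have hnorm : ∀ z : ℝ × ℝ, ‖z‖ ≤ Real.sqrt (z.1 ^ 2 + z.2 ^ 2) := by
    intro z
    rw [Prod.norm_def]
    refine max_le ?_ ?_
    · exact Real.abs_le_sqrt (by nlinarith [sq_nonneg z.2])
    · exact Real.abs_le_sqrt (by nlinarith [sq_nonneg z.1])
  refine ⟨δ / 2, by positivity, fun z hz hzδ => hKpos z hz ((hnorm z).trans hzδ), ?_⟩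
  intro ρ hρ0 hρ
  obtain ⟨n, rfl⟩ : ∃ n', n = n' + 1 := ⟨n - 1, by omega⟩
  set f : ℝ × ℝ → ℝ := fun z => if z = 0 then 0 else (K N z - K (n + 1) z) / K (n + 1) z with hf
  have hcore := core n f (by simp [hf]) (fun x => M x / D x)
    (fun w hw => by
      have hw0 : w ≠ 0 := by rintro rfl; simp at hw
      exact (hMs 0 w hw0).div (hDs 0 w hw0) (hD0 w hw0).ne')
    (fun t ht w hw => by
      have h0 := smul_ne_zero ht.ne' hw
      simp only [hf]
      rw [if_neg h0, hKN t ht w hw, hKn t ht w hw,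
        mul_div_mul_left _ _ (Real.rpow_pos_of_pos ht σ).ne', mul_div_assoc])
  have hev : ρ =ᶠ[𝓝 0] fun z => 1 + f z := by
    have hcont : Continuous fun z : ℝ × ℝ => Real.sqrt (z.1 ^ 2 + z.2 ^ 2) := by fun_prop
    have h1 : ∀ᶠ z in 𝓝 (0 : ℝ × ℝ), Real.sqrt (z.1 ^ 2 + z.2 ^ 2) < δ / 2 :=
      hcont.continuousAt.eventually_lt continuousAt_const (by simp [hδ])
    filter_upwards [h1] with z hz
    by_cases h0 : z = 0
    · subst h0; simp [hf, hρ0]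
    · have hp := hKpos z h0 ((hnorm z).trans hz.le)
      rw [hρ z h0 hz.le]
      simp only [hf]
      rw [if_neg h0]
      field_simp
      ring
  have hcd : ContDiffAt ℝ n ρ 0 :=
    (contDiffAt_const.add hcore.1).congr_of_eventuallyEq hev
  refine ⟨?_, ?_⟩
  · convert hcd using 1
    rfl
  · intro k hk1 hkn
    have hkn' : k ≤ n := by omega
    rw [(Filter.EventuallyEq.iteratedFDeriv ℝ hev k).self_of_nhds]
    have hfk : ContDiffAt ℝ k f 0 := hcore.1.of_le (by exact_mod_cast hkn')
    have := iteratedFDeriv_add_apply (x := (0 : ℝ × ℝ)) (i := k)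
      (f := fun _ : ℝ × ℝ => (1 : ℝ)) (g := f) contDiffAt_const hfk
    have e : (fun z => 1 + f z) = (fun _ : ℝ × ℝ => (1 : ℝ)) + f := rfl
    rw [e, this, hcore.2 k hkn', iteratedFDeriv_const_of_ne (by omega)]
    simp
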